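/- For every nonzero b ∈ ℂ, the set {b′ ∈ ℂ : b′ ≠ 0 and R(b′) = R(b)} has exactly three elements, namely b, ω·b and ω²·b, where ω is a primitive cube root of unity in ℂ. (This is the concrete form of the paper's lemma that the cone map ρ₃ of the twisted cubic is generically 3:1, the three preimages of ρ₃ at a general point lying on the unique bisecant line through that point.) -/

import Mathlib

open Polynomial

/-- For `b : ℂ`, the conic linear system `R₃(p)` on the twisted cubic, cut out by the cubic
cones with vertex `p = (b : 0 : 0 : −1)`: the ℂ-linear span of all products `u·v·w` with
`u, v, w ∈ {t, t², t³ + b}` inside `ℂ[t]`. -/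
noncomputable def conicSystem (b : ℂ) : Submodule ℂ (Polynomial ℂ) :=
  Submodule.span ℂ {p : Polynomial ℂ |
    ∃ u ∈ ({X, X ^ 2, X ^ 3 + C b} : Set (Polynomial ℂ)),
    ∃ v ∈ ({X, X ^ 2, X ^ 3 + C b} : Set (Polynomial ℂ)),
    ∃ w ∈ ({X, X ^ 2, X ^ 3 + C b} : Set (Polynomial ℂ)),
      p = u * v * w}

/-- The span of `t, …, t⁸` and `t⁹ + c`. -/
noncomputable def normalSystem (c : ℂ) : Submodule ℂ (Polynomial ℂ) :=
  Submodule.span ℂ (insert (X ^ 9 + C c) ((fun i : ℕ => (X : Polynomial ℂ) ^ i) '' Set.Icc 1 8))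

lemma X_pow_mem_normalSystem (c : ℂ) {i : ℕ} (h₁ : 1 ≤ i) (h₈ : i ≤ 8) :
    (X : Polynomial ℂ) ^ i ∈ normalSystem c :=
  Submodule.subset_span (Or.inr ⟨i, ⟨h₁, h₈⟩, rfl⟩)

lemma X_pow_nine_add_C_mem_normalSystem (c : ℂ) : X ^ 9 + C c ∈ normalSystem c :=
  Submodule.subset_span (Or.inl rfl)

lemma coeff_zero_of_mem_normalSystem {c : ℂ} {p : Polynomial ℂ} (hp : p ∈ normalSystem c) :
    p.coeff 0 = c * p.coeff 9 := by
  induction hp using Submodule.span_induction with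
  | mem p hp =>
    rcases hp with rfl | ⟨i, ⟨h₁, h₈⟩, rfl⟩
    · simp [coeff_C]
    · have h₀ : 0 ≠ i := by omega
      have h₉ : 9 ≠ i := by omega
      simp [coeff_X_pow, h₀, h₉]
  | zero => simp
  | add p q _ _ hp hq => simp [hp, hq, mul_add]
  | smul a p _ hp => simp [hp, mul_left_comm]

lemma eq_of_normalSystem_eq {c d : ℂ} (h : normalSystem c = normalSystem d) : c = d := by
  have := coeff_zero_of_mem_normalSystem (h ▸ X_pow_nine_add_C_mem_normalSystem c)
  simpa [coeff_C] using this

lemma conicSystem_le_normalSystem (b : ℂ) : conicSystem b ≤ normalSystem (b ^ 3) := by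
  have hX {i : ℕ} (h₁ : 1 ≤ i) (h₈ : i ≤ 8) := X_pow_mem_normalSystem (b ^ 3) h₁ h₈
  have hS (a : ℂ) {i : ℕ} (h₁ : 1 ≤ i) (h₈ : i ≤ 8) := Submodule.smul_mem _ a (hX h₁ h₈)
  have hxxz : (X ^ 5 + b • X ^ 2 : Polynomial ℂ) ∈ normalSystem (b ^ 3) :=
    add_mem (hX (by simp) (by simp)) (hS _ (by simp) (by simp))
  have hxyz : (X ^ 6 + b • X ^ 3 : Polynomial ℂ) ∈ normalSystem (b ^ 3) :=
    add_mem (hX (by simp) (by simp)) (hS _ (by simp) (by simp))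
  have hyyz : (X ^ 7 + b • X ^ 4 : Polynomial ℂ) ∈ normalSystem (b ^ 3) :=
    add_mem (hX (by simp) (by simp)) (hS _ (by simp) (by simp))
  have hxzz : (X ^ 7 + (2 * b) • X ^ 4 + b ^ 2 • X ^ 1 : Polynomial ℂ) ∈ normalSystem (b ^ 3) :=
    add_mem (add_mem (hX (by simp) (by simp)) (hS _ (by simp) (by simp)))
      (hS _ (by simp) (by simp))
  have hyzz : (X ^ 8 + (2 * b) • X ^ 5 + b ^ 2 • X ^ 2 : Polynomial ℂ) ∈ normalSystem (b ^ 3) :=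
    add_mem (add_mem (hX (by simp) (by simp)) (hS _ (by simp) (by simp)))
      (hS _ (by simp) (by simp))
  have hzzz : (X ^ 9 + C (b ^ 3) + (3 * b) • X ^ 6 + (3 * b ^ 2) • X ^ 3 : Polynomial ℂ) ∈
      normalSystem (b ^ 3) :=
    add_mem (add_mem (X_pow_nine_add_C_mem_normalSystem _) (hS _ (by simp) (by simp)))
      (hS _ (by simp) (by simp))
  have hxxx := hX (i := 3) (by simp) (by simp)
  have hxxy := hX (i := 4) (by simp) (by simp)
  have hxyy := hX (i := 5) (by simp) (by simp)
  have hyyy := hX (i := 6) (by simp) (by simp)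
  simp only [smul_eq_C_mul, map_mul, map_pow, C_ofNat] at hxxz hxyz hyyz hxzz hyzz hzzz
  have hE {p q : Polynomial ℂ} (hp : p ∈ normalSystem (b ^ 3)) (h : q = p) :
      q ∈ normalSystem (b ^ 3) := h ▸ hp
  refine Submodule.span_le.2 ?_
  rintro p ⟨u, rfl | rfl | rfl, v, rfl | rfl | rfl, w, rfl | rfl | rfl, rfl⟩ <;>
  first
  | exact hE hxxx (by ring1)
  | exact hE hxxy (by ring1)
  | exact hE hxyy (by ring1)
  | exact hE hyyy (by ring1)
  | exact hE hxxz (by ring1)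
  | exact hE hxyz (by ring1)
  | exact hE hyyz (by ring1)
  | exact hE hxzz (by ring1)
  | exact hE hyzz (by ring1)
  | exact hE hzzz (by ring1)

lemma normalSystem_le_conicSystem {b : ℂ} (hb : b ≠ 0) :
    normalSystem (b ^ 3) ≤ conicSystem b := by
  have hG {u v w : Polynomial ℂ} (hu : u ∈ ({X, X ^ 2, X ^ 3 + C b} : Set (Polynomial ℂ)))
      (hv : v ∈ ({X, X ^ 2, X ^ 3 + C b} : Set (Polynomial ℂ)))
      (hw : w ∈ ({X, X ^ 2, X ^ 3 + C b} : Set (Polynomial ℂ))) : u * v * w ∈ conicSystem b :=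
    Submodule.subset_span ⟨u, hu, v, hv, w, hw, rfl⟩
  have hx : X ∈ ({X, X ^ 2, X ^ 3 + C b} : Set (Polynomial ℂ)) := Or.inl rfl
  have hy : X ^ 2 ∈ ({X, X ^ 2, X ^ 3 + C b} : Set (Polynomial ℂ)) := Or.inr (Or.inl rfl)
  have hz : X ^ 3 + C b ∈ ({X, X ^ 2, X ^ 3 + C b} : Set (Polynomial ℂ)) := Or.inr (Or.inr rfl)
  have hS (a : ℂ) {p : Polynomial ℂ} (hp : p ∈ conicSystem b) : C a * p ∈ conicSystem b :=
    smul_eq_C_mul (p := p) a ▸ Submodule.smul_mem _ a hp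
  have hS' {a : ℂ} (ha : a ≠ 0) {p : Polynomial ℂ} (hp : C a * p ∈ conicSystem b) :
      p ∈ conicSystem b :=
    (Submodule.smul_mem_iff _ ha).1 (smul_eq_C_mul (p := p) a ▸ hp)
  have h₃ : (X : Polynomial ℂ) ^ 3 ∈ conicSystem b := by
    convert hG hx hx hx using 1; ring
  have h₄ : (X : Polynomial ℂ) ^ 4 ∈ conicSystem b := by
    convert hG hx hx hy using 1; ring
  have h₅ : (X : Polynomial ℂ) ^ 5 ∈ conicSystem b := by
    convert hG hx hy hy using 1; ring
  have h₆ : (X : Polynomial ℂ) ^ 6 ∈ conicSystem b := by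
    convert hG hy hy hy using 1; ring
  have h₇ : (X : Polynomial ℂ) ^ 7 ∈ conicSystem b := by
    convert sub_mem (hG hy hy hz) (hS b h₄) using 1; ring
  have h₂ : (X : Polynomial ℂ) ^ 2 ∈ conicSystem b := by
    refine hS' hb ?_
    convert sub_mem (hG hx hx hz) h₅ using 1; ring
  have h₁ : (X : Polynomial ℂ) ^ 1 ∈ conicSystem b := by
    refine hS' (pow_ne_zero 2 hb) ?_
    convert sub_mem (sub_mem (hG hx hz hz) h₇) (hS (2 * b) h₄) using 1
    simp only [map_mul, map_pow, C_ofNat]; ring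
  have h₈ : (X : Polynomial ℂ) ^ 8 ∈ conicSystem b := by
    convert sub_mem (sub_mem (hG hy hz hz) (hS (2 * b) h₅)) (hS (b ^ 2) h₂) using 1
    simp only [map_mul, map_pow, C_ofNat]; ring
  have h₉ : X ^ 9 + C (b ^ 3) ∈ conicSystem b := by
    convert sub_mem (sub_mem (hG hz hz hz) (hS (3 * b) h₆)) (hS (3 * b ^ 2) h₃) using 1
    simp only [map_mul, map_pow, C_ofNat]; ring
  refine Submodule.span_le.2 ?_
  rintro p (rfl | ⟨i, ⟨hi₁, hi₈⟩, rfl⟩)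
  · exact h₉
  · change X ^ i ∈ conicSystem b
    interval_cases i
    exacts [h₁, h₂, h₃, h₄, h₅, h₆, h₇, h₈]

lemma conicSystem_eq_normalSystem {b : ℂ} (hb : b ≠ 0) :
    conicSystem b = normalSystem (b ^ 3) :=
  le_antisymm (conicSystem_le_normalSystem b) (normalSystem_le_conicSystem hb)

lemma conicSystem_eq_iff {b b' : ℂ} (hb : b ≠ 0) (hb' : b' ≠ 0) :
    conicSystem b' = conicSystem b ↔ b' ^ 3 = b ^ 3 := by
  rw [conicSystem_eq_normalSystem hb, conicSystem_eq_normalSystem hb']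
  exact ⟨eq_of_normalSystem_eq, congrArg normalSystem⟩

/-- The cone map `ρ₃` of the twisted cubic is generically `3:1`: for every nonzero `b`,
and any primitive cube root of unity `ω`, the set of nonzero `b′` with `R(b′) = R(b)` is
exactly `{b, ω·b, ω²·b}`, and it has exactly three elements. -/
theorem conicSystem_fibre (b : ℂ) (hb : b ≠ 0) (ω : ℂ) (hω : IsPrimitiveRoot ω 3) :
    {b' : ℂ | b' ≠ 0 ∧ conicSystem b' = conicSystem b} = {b, ω * b, ω ^ 2 * b} ∧
      ({b, ω * b, ω ^ 2 * b} : Set ℂ).ncard = 3 := by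
  have hω₀ : ω ≠ 0 := hω.ne_zero (by norm_num)
  have hω₃ : ω ^ 3 = 1 := hω.pow_eq_one
  have hω₁ : ω ≠ 1 := hω.ne_one (by norm_num)
  have hω₂ : ω ^ 2 ≠ 1 := hω.pow_ne_one_of_pos_of_lt (by norm_num) (by norm_num)
  constructor
  · ext b'
    simp only [Set.mem_ofPred_eq, Set.mem_insert_iff, Set.mem_singleton_iff]
    constructor
    · rintro ⟨hb', h⟩
      rw [conicSystem_eq_iff hb hb'] at h
      obtain ⟨i, hi, hib⟩ := hω.eq_pow_of_pow_eq_one (ξ := b' / b)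
        (by rw [div_pow, h, div_self (pow_ne_zero 3 hb)])
      rw [eq_div_iff hb] at hib
      interval_cases i <;> simp [← hib]
    · rintro (rfl | rfl | rfl)
      · exact ⟨hb, rfl⟩
      · have h₀ := mul_ne_zero hω₀ hb
        exact ⟨h₀, (conicSystem_eq_iff hb h₀).2 (by rw [mul_pow, hω₃, one_mul])⟩
      · have h₀ := mul_ne_zero (pow_ne_zero 2 hω₀) hb
        exact ⟨h₀, (conicSystem_eq_iff hb h₀).2
          (by rw [mul_pow, pow_right_comm, hω₃, one_pow, one_mul])⟩
  · refine Set.ncard_eq_three.2 ⟨b, ω * b, ω ^ 2 * b, ?_, ?_, ?_, rfl⟩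
    · simpa [hb] using hω₁
    · simpa [hb] using hω₂
    · intro h
      have h' := mul_right_cancel₀ hb h
      exact hω₁ (mul_left_cancel₀ hω₀ (by rw [mul_one, ← sq, ← h']))
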